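/- arXiv:1702.07992 — 9 statements merged into one kernel-verified Lean document; each statement's English description precedes it below -/
import Mathlib

section
/- Let S be a share matrix such that each peer's total upload equals its total download, i.e. Σ_j S_{ij} = Σ_j S_{ji} for every i, and let x be the constant vector with x_i = α/(1+α) for every i. Then for every choice of weights β ∈ ℝ^N with β_i ∈ [0,1] and β_i = 0 whenever U_i(S,x)+D_i(S,x) = 0, the one-step SBCI update satisfies x'_i = α/(1+α) for every i. -/
open Finset

/-- Total "upload credit" of peer `i`: `U_i(S,x) = Σ_j S_{ij}·x_j`. -/
noncomputable def uAmt (N : ℕ) (S : Fin N → Fin N → ℝ) (x : Fin N → ℝ) (i : Fin N) : ℝ :=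
  ∑ j, S i j * x j

/-- Biased "download debit" of peer `i`:
`D_i(S,x) = α·Σ_j S_{ji}·x_j + (1−α)·Σ_j S_{ji}`. -/
noncomputable def dAmt (N : ℕ) (α : ℝ) (S : Fin N → Fin N → ℝ) (x : Fin N → ℝ) (i : Fin N) : ℝ :=
  α * ∑ j, S j i * x j + (1 - α) * ∑ j, S j i

/-- One-step SBCI update with weights `β`, with the convention `x'_i = x_i`
when `U_i(S,x) + D_i(S,x) = 0`. -/
noncomputable def sbciUpdate (N : ℕ) (α : ℝ) (S : Fin N → Fin N → ℝ)
    (x β : Fin N → ℝ) (i : Fin N) : ℝ :=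
  if uAmt N S x i + dAmt N α S x i = 0 then x i
  else (1 - β i) * x i + β i * (uAmt N S x i / (uAmt N S x i + dAmt N α S x i))

/-- If each peer's total upload equals its total download and `x` is the constant
vector `α/(1+α)`, then for every admissible choice of weights the one-step SBCI
update is again the constant vector `α/(1+α)`. -/
theorem stmt_0 (N : ℕ) (α : ℝ) (hα : 0 < α ∧ α < 1)
    (S : Fin N → Fin N → ℝ) (hS : ∀ i j, 0 ≤ S i j)
    (hbal : ∀ i : Fin N, ∑ j, S i j = ∑ j, S j i)
    (x : Fin N → ℝ) (hx : ∀ i, x i = α / (1 + α))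
    (β : Fin N → ℝ) (hβ : ∀ i, 0 ≤ β i ∧ β i ≤ 1)
    (hβ0 : ∀ i, uAmt N S x i + dAmt N α S x i = 0 → β i = 0) :
    ∀ i, sbciUpdate N α S x β i = α / (1 + α) := by
  intro i
  have h1 : (1 + α) ≠ 0 := by linarith [hα.1]
  have hu : uAmt N S x i = (∑ j, S j i) * (α / (1 + α)) := by
    simp only [uAmt, hx, ← Finset.sum_mul, hbal]
  have hs : uAmt N S x i + dAmt N α S x i = ∑ j, S j i := by
    rw [hu]
    simp only [dAmt, hx, ← Finset.sum_mul]
    field_simp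
    ring
  unfold sbciUpdate
  split_ifs with h
  · exact hx i
  · rw [hs] at h ⊢
    rw [hu, hx, mul_div_cancel_left₀ _ h]
    ring
end

section
/- Let S be a share matrix whose total transaction amount is positive, i.e. Σ_{i,j} S_{ij} > 0, let a > 0, let x be the constant vector with x_i = a for every i, and let β ∈ ℝ^N satisfy β_i ∈ (0,1] for every i. If the one-step SBCI update satisfies x'_i = a for every i, then a = α/(1+α) and Σ_j S_{ij} = Σ_j S_{ji} for every i (each peer's total upload equals its total download). -/
open Finset

/-- If the total transaction amount is positive, `x` is the constant vector `a > 0`,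
all weights lie in `(0,1]`, and the one-step SBCI update fixes the constant vector `a`,
then `a = α/(1+α)` and each peer's total upload equals its total download. -/
theorem stmt_1 (N : ℕ) (α : ℝ) (hα : 0 < α ∧ α < 1)
    (S : Fin N → Fin N → ℝ) (hS : ∀ i j, 0 ≤ S i j)
    (htot : 0 < ∑ i, ∑ j, S i j)
    (a : ℝ) (ha : 0 < a)
    (x : Fin N → ℝ) (hx : ∀ i, x i = a)
    (β : Fin N → ℝ) (hβ : ∀ i, 0 < β i ∧ β i ≤ 1)
    (hupd : ∀ i, sbciUpdate N α S x β i = a) :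
    a = α / (1 + α) ∧ ∀ i : Fin N, ∑ j, S i j = ∑ j, S j i := by
  obtain ⟨h0, h1⟩ := hα
  have hx' : x = fun _ => a := funext hx
  subst hx'
  have hc : 0 < α * a + 1 - α := by nlinarith [mul_pos h0 ha]
  have key : ∀ i, (∑ j, S i j) * (1 - a) = (α * a + 1 - α) * ∑ j, S j i := by
    intro i
    have hu := hupd i
    have ho : 0 ≤ ∑ j, S i j := Finset.sum_nonneg fun j _ => hS i j
    have hi : 0 ≤ ∑ j, S j i := Finset.sum_nonneg fun j _ => hS j i
    unfold sbciUpdate uAmt dAmt at hu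
    simp only [← Finset.sum_mul] at hu
    generalize (∑ j, S i j) = p at *
    generalize (∑ j, S j i) = q at *
    split_ifs at hu with hz
    · have e : p * a + (α * a + 1 - α) * q = 0 := by linarith
      have hp : 0 ≤ p * a := mul_nonneg ho ha.le
      have hq : 0 ≤ (α * a + 1 - α) * q := mul_nonneg hc.le hi
      have hp0 : p * a = 0 := by linarith
      have hq0 : (α * a + 1 - α) * q = 0 := by linarith
      have : p = 0 := by
        rcases mul_eq_zero.mp hp0 with h | h
        · exact h
        · exact absurd h ha.ne'
      rw [hq0, this, zero_mul]
    · have hb := (hβ i).1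
      have h2 : p * a / (p * a + (α * (q * a) + (1 - α) * q)) = a := by
        apply mul_left_cancel₀ hb.ne'
        linarith
      rw [div_eq_iff hz] at h2
      apply mul_left_cancel₀ ha.ne'
      linarith
  have hsum : (∑ i, ∑ j, S i j) * (1 - a) = (α * a + 1 - α) * ∑ i, ∑ j, S i j := by
    conv_rhs => rw [Finset.sum_comm]
    rw [Finset.sum_mul, Finset.mul_sum]
    exact Finset.sum_congr rfl fun i _ => key i
  have hac : 1 - a = α * a + 1 - α := by
    apply mul_left_cancel₀ htot.ne'
    linarith
  refine ⟨?_, fun i => ?_⟩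
  · rw [eq_div_iff (by linarith)]
    linarith
  · have := key i
    rw [hac, mul_comm] at this
    exact mul_left_cancel₀ hc.ne' this
end

section
/- Let S be an N×N real matrix with nonnegative entries whose total sum is positive, Σ_{i,j} S_{ij} > 0, and let a ∈ ℝ. If (a·α + 1 − α)·(Σ_j S_{ji}) = (1 − a)·(Σ_j S_{ij}) holds for every i, then a = α/(1+α). -/
open Finset

/-- If `S` is a nonnegative matrix with positive total sum and
`(a·α + 1 − α)·(Σ_j S_{ji}) = (1 − a)·(Σ_j S_{ij})` for every `i`,
then `a = α/(1+α)`. -/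
theorem stmt_2 (N : ℕ) (α : ℝ) (hα : 0 < α ∧ α < 1)
    (S : Fin N → Fin N → ℝ) (hS : ∀ i j, 0 ≤ S i j)
    (htot : 0 < ∑ i, ∑ j, S i j)
    (a : ℝ)
    (h : ∀ i : Fin N, (a * α + 1 - α) * (∑ j, S j i) = (1 - a) * (∑ j, S i j)) :
    a = α / (1 + α) := by
  have h1 : (a * α + 1 - α) * (∑ i, ∑ j, S j i) = (1 - a) * (∑ i, ∑ j, S i j) := by
    rw [Finset.mul_sum, Finset.mul_sum]
    exact Finset.sum_congr rfl (fun i _ => h i)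
  have h2 : ∑ i, ∑ j, S j i = ∑ i, ∑ j, S i j := Finset.sum_comm
  rw [h2] at h1
  have h3 := mul_right_cancel₀ htot.ne' h1
  have h4 : (1 + α) ≠ 0 := by
    have := hα.1
    positivity
  rw [eq_div_iff h4]
  linarith
end

section
/- Let S be a share matrix whose total transaction amount is positive, Σ_{i,j} S_{ij} > 0, let a > 0, let x be the constant vector with x_i = a for every i, and let β ∈ ℝ^N satisfy β_i ∈ (0,1] for every i. Then the one-step SBCI update satisfies x'_i = x_i for every i if and only if a = α/(1+α) and Σ_j S_{ij} = Σ_j S_{ji} for every i. -/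
open Finset

/-- For a share matrix with positive total transaction amount, a constant vector
`a > 0` and weights in `(0,1]`, the one-step SBCI update fixes `x` at every peer
iff `a = α/(1+α)` and each peer's total upload equals its total download. -/
theorem stmt_4 (N : ℕ) (α : ℝ) (hα : 0 < α ∧ α < 1)
    (S : Fin N → Fin N → ℝ) (hS : ∀ i j, 0 ≤ S i j)
    (htot : 0 < ∑ i, ∑ j, S i j)
    (a : ℝ) (ha : 0 < a)
    (x : Fin N → ℝ) (hx : ∀ i, x i = a)
    (β : Fin N → ℝ) (hβ : ∀ i, 0 < β i ∧ β i ≤ 1) :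
    (∀ i, sbciUpdate N α S x β i = x i) ↔
      (a = α / (1 + α) ∧ ∀ i : Fin N, ∑ j, S i j = ∑ j, S j i) := by
  have hc : 0 < α * a + (1 - α) := by nlinarith [mul_pos hα.1 ha, hα.2]
  have key : ∀ i, sbciUpdate N α S x β i = x i ↔
      (∑ j, S i j) * (1 - a) = (α * a + (1 - α)) * ∑ j, S j i := by
    intro i
    have hU : uAmt N S x i = a * ∑ j, S i j := by
      simp only [uAmt, hx, ← Finset.sum_mul]; ring
    have hD : dAmt N α S x i = (α * a + (1 - α)) * ∑ j, S j i := by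
      simp only [dAmt, hx, ← Finset.sum_mul]; ring
    have hu : 0 ≤ ∑ j, S i j := Finset.sum_nonneg fun j _ => hS i j
    have hd : 0 ≤ ∑ j, S j i := Finset.sum_nonneg fun j _ => hS j i
    unfold sbciUpdate
    rw [hU, hD, hx]
    generalize (∑ j, S i j) = u at *
    generalize (∑ j, S j i) = d at *
    generalize α * a + (1 - α) = c at *
    have h1 : 0 ≤ a * u := mul_nonneg ha.le hu
    have h2 : 0 ≤ c * d := mul_nonneg hc.le hd
    split_ifs with h
    · have h3 : a * u = 0 := by linarith
      have h4 : c * d = 0 := by linarith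
      have h5 : u = 0 := (mul_eq_zero.mp h3).resolve_left ha.ne'
      simp [h4, h5]
    · have hb := (hβ i).1
      constructor
      · intro e
        have e2 : β i * (a * u / (a * u + c * d)) = β i * a := by linarith
        have e3 := mul_left_cancel₀ hb.ne' e2
        rw [div_eq_iff h] at e3
        have e4 := mul_left_cancel₀ ha.ne' e3
        linarith
      · intro e
        have e3 : a * u / (a * u + c * d) = a := by
          rw [div_eq_iff h, ← e]; ring
        rw [e3]; ring
  simp only [key]
  have h1α : (1 + α) ≠ 0 := by linarith [hα.1]
  constructor
  · intro h
    have hs : (∑ i, ∑ j, S i j) * (1 - a) = (α * a + (1 - α)) * ∑ i, ∑ j, S i j := by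
      conv_rhs => rw [Finset.sum_comm]
      rw [Finset.sum_mul, Finset.mul_sum]
      exact Finset.sum_congr rfl fun i _ => h i
    rw [mul_comm] at hs
    have hac := mul_right_cancel₀ htot.ne' hs
    refine ⟨?_, fun i => ?_⟩
    · rw [eq_div_iff h1α]; linarith
    · have := h i
      rw [hac, mul_comm] at this
      exact mul_left_cancel₀ hc.ne' this
  · rintro ⟨h, hi⟩ i
    rw [eq_div_iff h1α] at h
    have : 1 - a = α * a + (1 - α) := by linarith
    rw [hi i, this, mul_comm]
end

section
/- Consider the multi-step SBCI process driven by share matrices S(0), …, S(n). Suppose peer i never uploads, i.e. Σ_j S(t)_{ij} = 0 for every t ≤ n, and that peer i downloads at some time, i.e. there exists m ≤ n with Σ_j S(m)_{ji} > 0. Then x_i(n+1) = 0: a peer who only downloads from the network has SBCI equal to zero. -/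
open Finset

/-- Weight `β_i(t)` of the multi-step SBCI process: `0` when peer `i` makes no
(effective) transaction, otherwise the fraction of the current transaction amount
to the total transaction amount up to time `t`. -/
noncomputable def betaAt (N : ℕ) (α : ℝ) (Ss : ℕ → Fin N → Fin N → ℝ)
    (x : Fin N → ℝ) (t : ℕ) (i : Fin N) : ℝ :=
  if uAmt N (Ss t) x i + dAmt N α (Ss t) x i = 0 then 0
  else (∑ j, (Ss t i j + Ss t j i)) /
    (∑ s ∈ Finset.range (t + 1), ∑ j, (Ss s i j + Ss s j i))

/-- The multi-step SBCI process driven by the share matrices `Ss 0, Ss 1, …`,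
initialized at `α/(1+α)`. -/
noncomputable def sbci (N : ℕ) (α : ℝ) (Ss : ℕ → Fin N → Fin N → ℝ) : ℕ → Fin N → ℝ
  | 0 => fun _ => α / (1 + α)
  | t + 1 => fun i =>
      sbciUpdate N α (Ss t) (sbci N α Ss t) (betaAt N α Ss (sbci N α Ss t) t) i

theorem sbci_nonneg_aux (N : ℕ) (α : ℝ) (hα : 0 < α ∧ α < 1)
    (Ss : ℕ → Fin N → Fin N → ℝ) (hS : ∀ t i j, 0 ≤ Ss t i j) (t : ℕ) :
    ∀ i, 0 ≤ sbci N α Ss t i := by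
  obtain ⟨h0, h1⟩ := hα
  induction t with
  | zero => intro i; simp only [sbci]; positivity
  | succ t ih =>
    intro i
    simp only [sbci, sbciUpdate, betaAt]
    have hU : 0 ≤ uAmt N (Ss t) (sbci N α Ss t) i :=
      Finset.sum_nonneg fun j _ => mul_nonneg (hS t i j) (ih j)
    have hD : 0 ≤ dAmt N α (Ss t) (sbci N α Ss t) i :=
      add_nonneg
        (mul_nonneg h0.le (Finset.sum_nonneg fun j _ => mul_nonneg (hS t j i) (ih j)))
        (mul_nonneg (by linarith) (Finset.sum_nonneg fun j _ => hS t j i))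
    have hT : ∀ s, 0 ≤ ∑ j, (Ss s i j + Ss s j i) := fun s =>
      Finset.sum_nonneg fun j _ => add_nonneg (hS s i j) (hS s j i)
    have hR : ∀ k, 0 ≤ ∑ s ∈ Finset.range k, ∑ j, (Ss s i j + Ss s j i) := fun k =>
      Finset.sum_nonneg fun s _ => hT s
    split_ifs with h
    · exact ih i
    · refine add_nonneg (mul_nonneg (sub_nonneg.2 (div_le_one_of_le₀ ?_ (hR _))) (ih i))
        (mul_nonneg (div_nonneg (hT _) (hR _)) (div_nonneg hU (add_nonneg hU hD)))
      rw [Finset.sum_range_succ]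
      linarith [hR t]

theorem sbci_mul_total_aux (N : ℕ) (α : ℝ) (hα : 0 < α ∧ α < 1)
    (Ss : ℕ → Fin N → Fin N → ℝ) (hS : ∀ t i j, 0 ≤ Ss t i j)
    (n : ℕ) (i : Fin N)
    (hnoup : ∀ t ≤ n, ∑ j, Ss t i j = 0) (t : ℕ) (ht : t ≤ n + 1) :
    sbci N α Ss t i * ∑ s ∈ Finset.range t, ∑ j, (Ss s i j + Ss s j i) = 0 := by
  induction t with
  | zero => simp
  | succ t ih =>
    have ih' := ih (by omega)
    have hz := hnoup t (by omega)
    have hz' : ∀ j, Ss t i j = 0 := fun j =>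
      (Finset.sum_eq_zero_iff_of_nonneg (fun j _ => hS t i j)).1 hz j (Finset.mem_univ j)
    have hU : uAmt N (Ss t) (sbci N α Ss t) i = 0 := by simp [uAmt, hz']
    have hx := sbci_nonneg_aux N α hα Ss hS t
    simp only [sbci, sbciUpdate, betaAt]
    split_ifs with h
    · have hA : 0 ≤ α * ∑ j, Ss t j i * sbci N α Ss t j :=
        mul_nonneg hα.1.le (Finset.sum_nonneg fun j _ => mul_nonneg (hS t j i) (hx j))
      have hB : 0 ≤ ∑ j, Ss t j i := Finset.sum_nonneg fun j _ => hS t j i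
      have hB0 : ∑ j, Ss t j i = 0 := by
        rw [hU, zero_add, dAmt] at h
        have h2 : (1 - α) * ∑ j, Ss t j i = 0 :=
          le_antisymm (by linarith) (mul_nonneg (by linarith [hα.2]) hB)
        exact (mul_eq_zero.1 h2).resolve_left (by linarith [hα.2])
      rw [Finset.sum_range_succ, Finset.sum_add_distrib, hz, hB0, add_zero, add_zero]
      exact ih'
    · rw [hU, zero_div, mul_zero, add_zero]
      by_cases hR : ∑ s ∈ Finset.range (t + 1), ∑ j, (Ss s i j + Ss s j i) = 0
      · rw [hR, mul_zero]
      · have e := Finset.sum_range_succ (fun s => ∑ j, (Ss s i j + Ss s j i)) t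
        generalize (∑ s ∈ Finset.range (t + 1), ∑ j, (Ss s i j + Ss s j i)) = R at *
        field_simp
        rw [e, add_sub_cancel_right]
        linarith

/-- In the multi-step SBCI process, a peer who never uploads up to time `n`
but downloads at some time `m ≤ n` has SBCI zero at time `n+1`. -/
theorem stmt_5 (N : ℕ) (α : ℝ) (hα : 0 < α ∧ α < 1)
    (Ss : ℕ → Fin N → Fin N → ℝ) (hS : ∀ t i j, 0 ≤ Ss t i j)
    (n : ℕ) (i : Fin N)
    (hnoup : ∀ t ≤ n, ∑ j, Ss t i j = 0)
    (hdl : ∃ m ≤ n, 0 < ∑ j, Ss m j i) :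
    sbci N α Ss (n + 1) i = 0 := by
  obtain ⟨m, hm, hpos⟩ := hdl
  have h := sbci_mul_total_aux N α hα Ss hS n i hnoup (n + 1) le_rfl
  refine (mul_eq_zero.1 h).resolve_right (ne_of_gt ?_)
  refine Finset.sum_pos' (fun s _ => Finset.sum_nonneg fun j _ =>
    add_nonneg (hS s i j) (hS s j i)) ⟨m, Finset.mem_range.2 (by omega), ?_⟩
  rw [Finset.sum_add_distrib, hnoup m hm, zero_add]
  exact hpos
end

section
/- Consider the multi-step SBCI process driven by share matrices S(0), …, S(n). Suppose peer i never downloads, i.e. Σ_j S(t)_{ji} = 0 for every t ≤ n, and suppose there exists m ≤ n such that peer i makes no transaction before time m (Σ_j (S(t)_{ij}+S(t)_{ji}) = 0 for every t < m) and at time m peer i uploads to at least one peer with positive SBCI, i.e. U_i(S(m),x(m)) > 0. Then x_i(t) = 1 for every t with m < t ≤ n+1: a peer who only uploads to the network (at least once to a non-free-rider) has SBCI equal to 1. -/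
open Finset

/-- In the multi-step SBCI process, a peer who never downloads up to time `n`,
makes no transaction before time `m ≤ n`, and at time `m` uploads to at least one
peer with positive SBCI, has SBCI equal to `1` at every time `t` with `m < t ≤ n+1`. -/
theorem stmt_6 (N : ℕ) (α : ℝ) (hα : 0 < α ∧ α < 1)
    (Ss : ℕ → Fin N → Fin N → ℝ) (hS : ∀ t i j, 0 ≤ Ss t i j)
    (n m : ℕ) (i : Fin N)
    (hnodl : ∀ t ≤ n, ∑ j, Ss t j i = 0)
    (hm : m ≤ n)
    (hquiet : ∀ t < m, ∑ j, (Ss t i j + Ss t j i) = 0)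
    (hup : 0 < uAmt N (Ss m) (sbci N α Ss m) i) :
    ∀ t, m < t → t ≤ n + 1 → sbci N α Ss t i = 1 := by
  have hd : ∀ t ≤ n, ∀ x : Fin N → ℝ, dAmt N α (Ss t) x i = 0 := by
    intro t ht x
    have h0 : ∀ j, Ss t j i = 0 := fun j =>
      (Finset.sum_eq_zero_iff_of_nonneg (fun j _ => hS t j i)).1 (hnodl t ht) j (Finset.mem_univ j)
    simp [dAmt, h0]
  have htot : ∑ j, (Ss m i j + Ss m j i) ≠ 0 := by
    intro h
    have h1 := (Finset.sum_eq_zero_iff_of_nonneg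
      (fun j _ => add_nonneg (hS m i j) (hS m j i))).1 h
    have h2 : ∀ j, Ss m i j = 0 := fun j => by
      have := h1 j (Finset.mem_univ j)
      linarith [hS m i j, hS m j i]
    simp [uAmt, h2] at hup
  intro t hmt
  induction t, hmt using Nat.le_induction with
  | base =>
    intro _
    have hq : ∑ s ∈ Finset.range m, ∑ j, (Ss s i j + Ss s j i) = 0 :=
      Finset.sum_eq_zero fun s hs => hquiet s (Finset.mem_range.1 hs)
    have hne := hup.ne'
    have hb : betaAt N α Ss (sbci N α Ss m) m i = 1 := by
      rw [betaAt, hd m hm, add_zero, if_neg hne, Finset.sum_range_succ, hq, zero_add,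
        div_self htot]
    change sbciUpdate N α (Ss m) (sbci N α Ss m) (betaAt N α Ss (sbci N α Ss m) m) i = 1
    rw [sbciUpdate, hd m hm, add_zero, if_neg hne, hb, div_self hne]
    ring
  | succ t hmt ih =>
    intro ht
    have hx := ih (by omega)
    change sbciUpdate N α (Ss t) (sbci N α Ss t) (betaAt N α Ss (sbci N α Ss t) t) i = 1
    rw [sbciUpdate, hd t (by omega), add_zero, hx]
    split_ifs with h
    · rfl
    · rw [div_self h]
      ring
end

section
/- Let S be a share matrix and x ∈ ℝ^N with nonnegative entries. Suppose peer i uploads to at least one non-free-rider and downloads nothing, i.e. U_i(S,x) > 0 and Σ_j S_{ji} = 0, and suppose x_i < 1 and β_i ∈ (0,1). Then the one-step SBCI update satisfies x_i < x'_i < 1: uploading to a peer other than a free-rider strictly increases the SBCI. -/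
open Finset

/-- Uploading to at least one non-free-rider while downloading nothing strictly
increases the SBCI (provided `x_i < 1` and `β_i ∈ (0,1)`), and keeps it below `1`. -/
theorem stmt_8 (N : ℕ) (α : ℝ) (hα : 0 < α ∧ α < 1)
    (S : Fin N → Fin N → ℝ) (hS : ∀ i j, 0 ≤ S i j)
    (x : Fin N → ℝ) (hx : ∀ j, 0 ≤ x j)
    (i : Fin N)
    (hU : 0 < uAmt N S x i)
    (hnodl : ∑ j, S j i = 0)
    (hxi : x i < 1)
    (β : Fin N → ℝ) (hβ : 0 < β i ∧ β i < 1) :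
    x i < sbciUpdate N α S x β i ∧ sbciUpdate N α S x β i < 1 := by
  have h0 : ∀ j, S j i = 0 := fun j =>
    (Finset.sum_eq_zero_iff_of_nonneg (fun j _ => hS j i)).1 hnodl j (Finset.mem_univ j)
  have hD : dAmt N α S x i = 0 := by simp [dAmt, h0]
  have h : sbciUpdate N α S x β i = (1 - β i) * x i + β i := by
    simp [sbciUpdate, hD, hU.ne']
  rw [h]
  obtain ⟨h1, h2⟩ := hβ
  constructor <;> nlinarith
end

section
/- Let S be a share matrix, let β_i ∈ [0,1] be a fixed weight for peer i, and let x, y ∈ ℝ^N be nonnegative vectors with x_j ≤ y_j for every j and y_k = x_k for every k with S_{ki} > 0 (the SBCIs of the peers that i downloads from are unchanged). If U_i(S,x)+D_i(S,x) > 0, then the one-step SBCI update of peer i computed with y is at least that computed with x; moreover, if in addition β_i > 0, D_i(S,x) > 0, and there exists j with S_{ij} > 0 and y_j > x_j, the inequality is strict. Hence a peer earns a higher SBCI by uploading to higher-SBCI peers. -/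
open Finset

/-- One-step SBCI update of peer `i`, computed from the vector `z` but using the
fixed initial value `x0` for peer `i` itself. -/
noncomputable def sbciUpdateAt (N : ℕ) (α : ℝ) (S : Fin N → Fin N → ℝ)
    (x0 : ℝ) (z : Fin N → ℝ) (βi : ℝ) (i : Fin N) : ℝ :=
  if uAmt N S z i + dAmt N α S z i = 0 then x0
  else (1 - βi) * x0 + βi * (uAmt N S z i / (uAmt N S z i + dAmt N α S z i))

/-- If the SBCIs of the peers that `i` downloads from are unchanged while the other
SBCIs do not decrease, then the one-step SBCI update of peer `i` does not decrease;
it strictly increases when `β_i > 0`, `D_i(S,x) > 0`, and some peer that `i`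
uploads to strictly increased its SBCI.  Hence a peer earns a higher SBCI by
uploading to higher-SBCI peers. -/
theorem stmt_12 (N : ℕ) (α : ℝ) (hα : 0 < α ∧ α < 1)
    (S : Fin N → Fin N → ℝ) (hS : ∀ i j, 0 ≤ S i j)
    (i : Fin N) (βi : ℝ) (hβ : 0 ≤ βi ∧ βi ≤ 1)
    (x y : Fin N → ℝ) (hx : ∀ j, 0 ≤ x j) (hy : ∀ j, 0 ≤ y j)
    (hxy : ∀ j, x j ≤ y j)
    (hfix : ∀ k, 0 < S k i → y k = x k)
    (hpos : 0 < uAmt N S x i + dAmt N α S x i) :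
    sbciUpdateAt N α S (x i) x βi i ≤ sbciUpdateAt N α S (x i) y βi i ∧
      ((0 < βi ∧ 0 < dAmt N α S x i ∧ ∃ j, 0 < S i j ∧ x j < y j) →
        sbciUpdateAt N α S (x i) x βi i < sbciUpdateAt N α S (x i) y βi i) := by
  have hD : dAmt N α S y i = dAmt N α S x i := by
    unfold dAmt
    have h : ∑ j, S j i * y j = ∑ j, S j i * x j := by
      refine Finset.sum_congr rfl fun k _ => ?_
      rcases (hS k i).lt_or_eq with h | h
      · rw [hfix k h]
      · rw [← h]; simp
    rw [h]
  have hD0 : 0 ≤ dAmt N α S x i := by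
    unfold dAmt
    have h1 : 0 ≤ ∑ j, S j i * x j :=
      Finset.sum_nonneg fun j _ => mul_nonneg (hS j i) (hx j)
    have h2 : 0 ≤ ∑ j, S j i := Finset.sum_nonneg fun j _ => hS j i
    have h3 : 0 ≤ 1 - α := by linarith [hα.2]
    exact add_nonneg (mul_nonneg hα.1.le h1) (mul_nonneg h3 h2)
  have hU : uAmt N S x i ≤ uAmt N S y i :=
    Finset.sum_le_sum fun j _ => mul_le_mul_of_nonneg_left (hxy j) (hS i j)
  have hUs : (∃ j, 0 < S i j ∧ x j < y j) → uAmt N S x i < uAmt N S y i := by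
    rintro ⟨j, hj, hlt⟩
    exact Finset.sum_lt_sum
      (fun j _ => mul_le_mul_of_nonneg_left (hxy j) (hS i j))
      ⟨j, Finset.mem_univ j, mul_lt_mul_of_pos_left hlt hj⟩
  have hpos' : 0 < uAmt N S y i + dAmt N α S x i := by linarith
  unfold sbciUpdateAt
  rw [hD, if_neg hpos.ne', if_neg hpos'.ne']
  constructor
  · have h : uAmt N S x i / (uAmt N S x i + dAmt N α S x i)
        ≤ uAmt N S y i / (uAmt N S y i + dAmt N α S x i) := by
      rw [div_le_div_iff₀ hpos hpos']
      nlinarith [mul_le_mul_of_nonneg_right hU hD0]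
    linarith [mul_le_mul_of_nonneg_left h hβ.1]
  · rintro ⟨hb, hd, hj⟩
    have h : uAmt N S x i / (uAmt N S x i + dAmt N α S x i)
        < uAmt N S y i / (uAmt N S y i + dAmt N α S x i) := by
      rw [div_lt_div_iff₀ hpos hpos']
      nlinarith [mul_lt_mul_of_pos_right (hUs hj) hd]
    linarith [mul_lt_mul_of_pos_left h hb]
end

section
/- Let S be a share matrix, let β_i ∈ [0,1] be a fixed weight for peer i, and let x, y ∈ ℝ^N be nonnegative vectors with x_j ≤ y_j for every j and y_k = x_k for every k with S_{ik} > 0 (the SBCIs of the peers that i uploads to are unchanged). If U_i(S,x)+D_i(S,x) > 0, then the one-step SBCI update of peer i computed with y is at most that computed with x; moreover, if in addition β_i > 0, U_i(S,x) > 0, and there exists k with S_{ki} > 0 and y_k > x_k, the inequality is strict. Hence a peer loses less SBCI by downloading from lower-SBCI peers. -/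
open Finset

/-- If the SBCIs of the peers that `i` uploads to are unchanged while the other
SBCIs do not decrease, then the one-step SBCI update of peer `i` does not increase;
it strictly decreases when `β_i > 0`, `U_i(S,x) > 0`, and some peer that `i`
downloads from strictly increased its SBCI.  Hence a peer loses less SBCI by
downloading from lower-SBCI peers. -/
theorem stmt_13 (N : ℕ) (α : ℝ) (hα : 0 < α ∧ α < 1)
    (S : Fin N → Fin N → ℝ) (hS : ∀ i j, 0 ≤ S i j)
    (i : Fin N) (βi : ℝ) (hβ : 0 ≤ βi ∧ βi ≤ 1)
    (x y : Fin N → ℝ) (hx : ∀ j, 0 ≤ x j) (hy : ∀ j, 0 ≤ y j)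
    (hxy : ∀ j, x j ≤ y j)
    (hfix : ∀ k, 0 < S i k → y k = x k)
    (hpos : 0 < uAmt N S x i + dAmt N α S x i) :
    sbciUpdateAt N α S (x i) y βi i ≤ sbciUpdateAt N α S (x i) x βi i ∧
      ((0 < βi ∧ 0 < uAmt N S x i ∧ ∃ k, 0 < S k i ∧ x k < y k) →
        sbciUpdateAt N α S (x i) y βi i < sbciUpdateAt N α S (x i) x βi i) := by
  have hU : uAmt N S y i = uAmt N S x i := by
    unfold uAmt
    refine Finset.sum_congr rfl fun j _ => ?_
    rcases (hS i j).eq_or_lt with h | h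
    · rw [← h]; simp
    · rw [hfix j h]
  have hle : ∀ j ∈ Finset.univ, S j i * x j ≤ S j i * y j := fun j _ =>
    mul_le_mul_of_nonneg_left (hxy j) (hS j i)
  have hD : dAmt N α S x i ≤ dAmt N α S y i := by
    have := mul_le_mul_of_nonneg_left (Finset.sum_le_sum hle) hα.1.le
    unfold dAmt
    linarith
  have hU0 : 0 ≤ uAmt N S x i :=
    Finset.sum_nonneg fun j _ => mul_nonneg (hS i j) (hx j)
  have hpy : 0 < uAmt N S x i + dAmt N α S y i := by linarith
  unfold sbciUpdateAt
  rw [hU, if_neg hpos.ne', if_neg hpy.ne']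
  constructor
  · have h1 := div_le_div_of_nonneg_left hU0 hpos (add_le_add_right hD (uAmt N S x i))
    have := mul_le_mul_of_nonneg_left h1 hβ.1
    linarith
  · rintro ⟨hb, hu, k, hk, hxk⟩
    have hlt : dAmt N α S x i < dAmt N α S y i := by
      have h2 := Finset.sum_lt_sum hle ⟨k, Finset.mem_univ k, mul_lt_mul_of_pos_left hxk hk⟩
      have := mul_lt_mul_of_pos_left h2 hα.1
      unfold dAmt
      linarith
    have h1 := div_lt_div_of_pos_left hu hpos (add_lt_add_right hlt (uAmt N S x i))
    have := mul_lt_mul_of_pos_left h1 hb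
    linarith
end
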